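/- Let μ be a Borel probability measure on ℝ with supp μ = [0,1]. Suppose there exist constants C > 0, ε₀ > 0 and a Borel set A ⊆ [0,1] of positive Lebesgue measure such that μ(B(x,δ)) ≤ C · 2δ for every 0 < δ < ε₀ and every x ∈ ℝ at distance at most ε₀ from A. Then B_μ(q) ≥ 1 − q for every q < 1; consequently the left derivative of B_μ at 1 satisfies B_{μ−}'(1) ≤ −1. -/

import Mathlib

open Filter Set Metric MeasureTheory Topology ENNReal

noncomputable section

variable {X : Type*} [MetricSpace X] [MeasurableSpace X]

/-- The (topological) support of a Borel measure. -/
def msupp (μ : Measure X) : Set X := {x | ∀ r > 0, 0 < μ (ball x r)}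

/-- `(B(x i, r i))_{i ∈ I}` is a centered `ε`-packing of `E` : the centers lie in `E`,
the radii are positive and at most `ε`, and the closed balls are pairwise disjoint. -/
def IsCPacking (E : Set X) (ε : ℝ) (I : Set ℕ) (x : ℕ → X) (r : ℕ → ℝ) : Prop :=
  (∀ i ∈ I, x i ∈ E ∧ 0 < r i ∧ r i ≤ ε) ∧
  I.PairwiseDisjoint (fun i => closedBall (x i) (r i))

/-- The sum `Σ_i μ(B(x_i,r_i))^q (2 r_i)^t` associated to a packing.  Note that
`ENNReal.rpow` satisfies exactly the conventions `0^q = ∞` for `q < 0` and `0^0 = 1`. -/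
def packSum (μ : Measure X) (q t : ℝ) (I : Set ℕ) (x : ℕ → X) (r : ℕ → ℝ) : ℝ≥0∞ :=
  ∑' i : I, μ (closedBall (x i.1) (r i.1)) ^ q * ENNReal.ofReal (2 * r i.1) ^ t

/-- `P̄^{q,t}_{μ,ε}(E)`. -/
def prePackPre (μ : Measure X) (q t ε : ℝ) (E : Set X) : ℝ≥0∞ :=
  ⨆ (I : Set ℕ) (x : ℕ → X) (r : ℕ → ℝ) (_ : IsCPacking E ε I x r), packSum μ q t I x r

/-- The prepacking measure `P̄^{q,t}_μ(E) = lim_{ε→0} P̄^{q,t}_{μ,ε}(E)`;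
since `ε ↦ P̄^{q,t}_{μ,ε}(E)` is monotone, the limit is the infimum over `ε > 0`. -/
def prePack (μ : Measure X) (q t : ℝ) (E : Set X) : ℝ≥0∞ :=
  ⨅ (ε : ℝ) (_ : 0 < ε), prePackPre μ q t ε E

/-- The packing measure `P^{q,t}_μ(E)`, obtained from `P̄^{q,t}_μ` by countable covers. -/
def packMeas (μ : Measure X) (q t : ℝ) (E : Set X) : ℝ≥0∞ :=
  ⨅ (F : ℕ → Set X) (_ : E ⊆ ⋃ i, F i), ∑' i, prePack μ q t (F i)

/-- The prepacking dimension `Δ^q_μ(E) = inf {t : P̄^{q,t}_μ(E) = 0}` (`+∞` if no such `t`). -/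
def mfDelta (μ : Measure X) (q : ℝ) (E : Set X) : EReal :=
  ⨅ (t : ℝ) (_ : prePack μ q t E = 0), (t : EReal)

/-- The packing dimension `Dim^q_μ(E) = inf {t : P^{q,t}_μ(E) = 0}` (`+∞` if no such `t`). -/
def mfDim (μ : Measure X) (q : ℝ) (E : Set X) : EReal :=
  ⨅ (t : ℝ) (_ : packMeas μ q t E = 0), (t : EReal)

/-- `Dim(E) = Dim^0_μ(E)`, the packing dimension. -/
def pDim (μ : Measure X) (E : Set X) : EReal := mfDim μ 0 E

/-- `Δ(E) = Δ^0_μ(E)`, the prepacking dimension. -/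
def pDelta (μ : Measure X) (E : Set X) : EReal := mfDelta μ 0 E

/-- `B_μ(q) = Dim^q_μ(supp μ)`. -/
def Bmu (μ : Measure X) (q : ℝ) : EReal := mfDim μ q (msupp μ)

/-- `Λ_μ(q) = Δ^q_μ(supp μ)`. -/
def Lammu (μ : Measure X) (q : ℝ) : EReal := mfDelta μ q (msupp μ)

/-- `X̄^α = {x ∈ supp μ : limsup_{r→0} log μ(B(x,r)) / log r ≤ α}`. -/
def Xbar (μ : Measure X) (α : ℝ) : Set X :=
  {x ∈ msupp μ |
    limsup (fun r => Real.log (μ (closedBall x r)).toReal / Real.log r) (𝓝[>] (0:ℝ)) ≤ α}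

/-- `X_α(η,p) = {x ∈ X̄^α : ∀ r > 0, 2r ≥ 1/p or (2r)^η ≤ μ(B(x,r))}`. -/
def Xae (μ : Measure X) (α η : ℝ) (p : ℕ) : Set X :=
  {x ∈ Xbar μ α |
    ∀ r : ℝ, 0 < r →
      (1 : ℝ) / (p : ℝ) ≤ 2 * r ∨ ENNReal.ofReal ((2 * r) ^ η) ≤ μ (closedBall x r)}

/-- Property `P_k` : the family `(B(y i, δ i))_{i ∈ I}` splits into at most `k` parts,
each of which is a centered `uε`-packing of `M`. -/
def HasPk (M : Set X) (uε : ℝ) (k : ℕ) (I : Set ℕ) (y : ℕ → X) (δ : ℕ → ℝ) : Prop :=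
  ∃ c : ℕ → Fin k, ∀ j : Fin k, IsCPacking M uε {i ∈ I | c i = j} y δ

/-- `L^k_{ε,(B(x_i,r_i))}(M)` : infimum over families with property `P_k` of
`sup_{i∈I} log μ(B(y_i,δ_i)) / log (2 r_i)`. -/
def Lpack (μ : Measure X) (u : ℝ → ℝ) (k : ℕ) (ε : ℝ) (M : Set X)
    (I : Set ℕ) (x : ℕ → X) (r : ℕ → ℝ) : EReal :=
  ⨅ (y : ℕ → X) (δ : ℕ → ℝ) (_ : HasPk M (u ε) k I y δ),
    ⨆ i : I,
      ((Real.log (μ (closedBall (y i.1) (δ i.1))).toReal / Real.log (2 * r i.1) : ℝ) : EReal)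

/-- `L^k_ε(M)` : supremum over all centered `ε`-packings of `M`. -/
def Leps (μ : Measure X) (u : ℝ → ℝ) (k : ℕ) (ε : ℝ) (M : Set X) : EReal :=
  ⨆ (I : Set ℕ) (x : ℕ → X) (r : ℕ → ℝ) (_ : IsCPacking M ε I x r),
    Lpack μ u k ε M I x r

/-- `L^k(M) = lim_{ε→0} L^k_ε(M)`; the function being monotone in `ε`,
the limit is the infimum over `ε > 0`. -/
def Lk (μ : Measure X) (u : ℝ → ℝ) (k : ℕ) (M : Set X) : EReal :=
  ⨅ (ε : ℝ) (_ : 0 < ε), Leps μ u k ε M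

/-- `L(M) = lim_{k→∞} L^k(M)`; the sequence being nonincreasing, this is the infimum. -/
def Lfun (μ : Measure X) (u : ℝ → ℝ) (M : Set X) : EReal :=
  ⨅ (k : ℕ) (_ : 1 ≤ k), Lk μ u k M

/-- `T_μ(α,η,p) = sup {L(M) : M ⊆ X_α(η,p)}`. -/
def Tp (μ : Measure X) (u : ℝ → ℝ) (α η : ℝ) (p : ℕ) : EReal :=
  ⨆ (M : Set X) (_ : M ⊆ Xae μ α η p), Lfun μ u M

/-- `T_μ(α,η) = lim_{p→∞} T_μ(α,η,p)`; the sequence being nondecreasing, this is the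
supremum over `p ≥ 1`. -/
def Teta (μ : Measure X) (u : ℝ → ℝ) (α η : ℝ) : EReal :=
  ⨆ (p : ℕ) (_ : 1 ≤ p), Tp μ u α η p

/-- `T_μ(α) = lim_{η→α⁺} T_μ(α,η)`; the function being nondecreasing in `η`, this is the
infimum over `η > α`. -/
def Tfun (μ : Measure X) (u : ℝ → ℝ) (α : ℝ) : EReal :=
  ⨅ (η : ℝ) (_ : α < η), Teta μ u α η

theorem measure_compl_msupp [SecondCountableTopology X] (μ : Measure X) :
    μ (msupp μ)ᶜ = 0 := by
  refine measure_null_of_locally_null _ fun x hx => ?_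
  simp only [msupp, mem_compl_iff, mem_ofPred_eq, not_forall, not_lt, nonpos_iff_eq_zero] at hx
  obtain ⟨r, hr, h0⟩ := hx
  exact ⟨ball x r, mem_nhdsWithin_of_mem_nhds (ball_mem_nhds x hr), h0⟩

theorem rpow_sub_one_mul_le_rpow_mul_rpow {m c R : ℝ≥0∞} {q t : ℝ} (hq : q < 1)
    (ht : t < 1 - q) (hm : m ≠ ⊤) (hc : c ≠ ⊤) (hR₀ : R ≠ 0) (hR₁ : R ≤ 1)
    (hmR : m ≤ c * R) : c ^ (q - 1) * m ≤ m ^ q * R ^ t := by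
  rcases eq_or_ne m 0 with rfl | hm₀
  · simp
  have hR : R ≠ ⊤ := ne_top_of_le_ne_top one_ne_top hR₁
  have hsplit : m ^ q = m ^ (q - 1) * m := by
    conv_lhs => rw [show q = q - 1 + 1 by ring, ENNReal.rpow_add _ _ hm₀ hm, ENNReal.rpow_one]
  have hpow : c ^ (q - 1) * R ^ (q - 1) ≤ m ^ (q - 1) := by
    rw [← ENNReal.mul_rpow_of_ne_top hc hR, show q - 1 = -(1 - q) by ring, ENNReal.rpow_neg,
      ENNReal.rpow_neg]
    exact ENNReal.inv_le_inv.2 (ENNReal.rpow_le_rpow hmR (by linarith))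
  have hone : 1 ≤ R ^ (q - 1) * R ^ t := by
    rw [← ENNReal.rpow_add _ _ hR₀ hR]
    exact ENNReal.one_le_rpow_of_pos_of_le_one_of_neg (pos_iff_ne_zero.2 hR₀) hR₁ (by linarith)
  calc c ^ (q - 1) * m ≤ c ^ (q - 1) * m * (R ^ (q - 1) * R ^ t) := le_mul_of_one_le_right' hone
    _ = c ^ (q - 1) * R ^ (q - 1) * m * R ^ t := by ring
    _ ≤ m ^ (q - 1) * m * R ^ t := by gcongr
    _ = m ^ q * R ^ t := by rw [hsplit]

/-- A consequence of the Besicovitch covering theorem: packings of `E` at arbitrarily small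
scales can carry all the outer measure of `E`. -/
theorem exists_isCPacking_measure_le_tsum (μ : Measure ℝ) [SFinite μ] (E : Set ℝ) {ε : ℝ}
    (hε : 0 < ε) :
    ∃ (I : Set ℕ) (x r : ℕ → ℝ), IsCPacking E ε I x r ∧
      μ E ≤ ∑' i : I, μ (closedBall (x i.1) (r i.1)) := by
  obtain ⟨s, ρ, hs, hsE, hρ, hcov, hdisj⟩ :=
    Besicovitch.exists_disjoint_closedBall_covering_ae μ (fun _ => univ) E
      (fun x _ δ hδ => ⟨δ / 2, mem_univ _, half_pos hδ, half_lt_self hδ⟩)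
      (fun _ => ε) (fun _ _ => hε)
  obtain ⟨g, hg⟩ := countable_iff_exists_injOn.1 hs
  have hinv : ∀ y ∈ s, Function.invFunOn g s (g y) = y := fun y hy =>
    hg.leftInvOn_invFunOn hy
  refine ⟨g '' s, Function.invFunOn g s, fun n => ρ (Function.invFunOn g s n), ⟨?_, ?_⟩, ?_⟩
  · rintro _ ⟨y, hy, rfl⟩
    simp only [hinv y hy]
    exact ⟨hsE hy, (hρ y hy).2.1, (hρ y hy).2.2.le⟩
  · rintro _ ⟨y, hy, rfl⟩ _ ⟨z, hz, rfl⟩ hne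
    simp only [Function.onFun, hinv y hy, hinv z hz]
    exact hdisj hy hz (fun h => hne (by rw [h]))
  · have : Countable s := hs.to_subtype
    have hsum : ∑' i : g '' s, μ (closedBall (Function.invFunOn g s i.1)
        (ρ (Function.invFunOn g s i.1))) = ∑' y : s, μ (closedBall y.1 (ρ y.1)) := by
      rw [tsum_image (fun n => μ (closedBall (Function.invFunOn g s n)
        (ρ (Function.invFunOn g s n)))) hg]
      exact tsum_congr fun y => by rw [hinv y.1 y.2]
    rw [hsum]
    calc μ E ≤ μ (⋃ y ∈ s, closedBall y (ρ y)) + μ (E \ ⋃ y ∈ s, closedBall y (ρ y)) := by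
          refine (measure_mono ?_).trans (measure_union_le _ _)
          rw [union_sdiff_self]
          exact subset_union_right
      _ = μ (⋃ y ∈ s, closedBall y (ρ y)) := by rw [hcov, add_zero]
      _ ≤ ∑' y : s, μ (closedBall y.1 (ρ y.1)) := measure_biUnion_le μ hs _

theorem rpow_mul_measure_le_prePack (μ : Measure ℝ) [IsFiniteMeasure μ] {C ε₀ q t : ℝ}
    (hε₀ : 0 < ε₀) (hq : q < 1) (ht : t < 1 - q) {E U : Set ℝ}
    (hU : ∀ δ : ℝ, 0 < δ → δ < ε₀ → ∀ x ∈ U,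
      μ (closedBall x δ) ≤ ENNReal.ofReal C * ENNReal.ofReal (2 * δ)) :
    ENNReal.ofReal C ^ (q - 1) * μ (E ∩ U) ≤ prePack μ q t E := by
  refine le_iInf₂ fun ε hε => ?_
  obtain ⟨I, x, r, ⟨hI, hdisj⟩, hμ⟩ := exists_isCPacking_measure_le_tsum μ (E ∩ U)
    (ε := min ε (min (ε₀ / 2) (1 / 2))) (by positivity)
  have hpack : IsCPacking E ε I x r :=
    ⟨fun i hi => ⟨(hI i hi).1.1, (hI i hi).2.1, (hI i hi).2.2.trans (min_le_left _ _)⟩, hdisj⟩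
  have hsum : ENNReal.ofReal C ^ (q - 1) * μ (E ∩ U) ≤ packSum μ q t I x r := by
    refine (mul_le_mul_right hμ _).trans ?_
    rw [← ENNReal.tsum_mul_left]
    refine ENNReal.tsum_le_tsum fun i => ?_
    obtain ⟨⟨-, hxU⟩, hr, hle⟩ := hI i.1 i.2
    simp only [le_min_iff] at hle
    refine rpow_sub_one_mul_le_rpow_mul_rpow hq ht (measure_ne_top _ _) ENNReal.ofReal_ne_top
      ?_ ?_ (hU _ hr (by linarith) _ hxU)
    · exact (ENNReal.ofReal_pos.2 (by linarith)).ne'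
    · exact ENNReal.ofReal_le_one.2 (by linarith)
  refine hsum.trans ?_
  unfold prePackPre
  exact le_iSup_of_le I (le_iSup_of_le x (le_iSup_of_le r (le_iSup_of_le hpack le_rfl)))

theorem rpow_mul_measure_le_packMeas (μ : Measure ℝ) [IsFiniteMeasure μ] {C ε₀ q t : ℝ}
    (hε₀ : 0 < ε₀) (hq : q < 1) (ht : t < 1 - q) {E U : Set ℝ}
    (hU : ∀ δ : ℝ, 0 < δ → δ < ε₀ → ∀ x ∈ U,
      μ (closedBall x δ) ≤ ENNReal.ofReal C * ENNReal.ofReal (2 * δ)) :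
    ENNReal.ofReal C ^ (q - 1) * μ (E ∩ U) ≤ packMeas μ q t E := by
  refine le_iInf₂ fun F hF => ?_
  calc ENNReal.ofReal C ^ (q - 1) * μ (E ∩ U)
      ≤ ENNReal.ofReal C ^ (q - 1) * ∑' i, μ (F i ∩ U) := by
        gcongr
        refine (measure_mono (inter_subset_inter_left U hF)).trans ?_
        rw [iUnion_inter]
        exact measure_iUnion_le _
    _ = ∑' i, ENNReal.ofReal C ^ (q - 1) * μ (F i ∩ U) := ENNReal.tsum_mul_left.symm
    _ ≤ ∑' i, prePack μ q t (F i) :=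
        ENNReal.tsum_le_tsum fun i => rpow_mul_measure_le_prePack μ hε₀ hq ht hU

theorem packSum_one_le [BorelSpace X] (μ : Measure X) [IsProbabilityMeasure μ] {t ε : ℝ}
    (ht : 0 ≤ t) {E : Set X} {I : Set ℕ} {x : ℕ → X} {r : ℕ → ℝ} (h : IsCPacking E ε I x r) :
    packSum μ 1 t I x r ≤ ENNReal.ofReal (2 * ε) ^ t := by
  calc packSum μ 1 t I x r
      ≤ ∑' i : I, μ (closedBall (x i.1) (r i.1)) * ENNReal.ofReal (2 * ε) ^ t := by
        refine ENNReal.tsum_le_tsum fun i => ?_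
        rw [ENNReal.rpow_one]
        have := (h.1 i.1 i.2).2.2
        gcongr
    _ = (∑' i : I, μ (closedBall (x i.1) (r i.1))) * ENNReal.ofReal (2 * ε) ^ t :=
        ENNReal.tsum_mul_right
    _ ≤ 1 * ENNReal.ofReal (2 * ε) ^ t := by
        gcongr
        refine (tsum_meas_le_meas_iUnion_of_disjoint
          (As := fun i : I => closedBall (x i.1) (r i.1)) μ (fun _ => measurableSet_closedBall)
          fun i j hij => h.2 i.2 j.2 fun h' => hij (Subtype.ext h')).trans prob_le_one
    _ = ENNReal.ofReal (2 * ε) ^ t := one_mul _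

theorem prePack_one_eq_zero [BorelSpace X] (μ : Measure X) [IsProbabilityMeasure μ] {t : ℝ}
    (ht : 0 < t) (E : Set X) : prePack μ 1 t E = 0 := by
  have hle : ∀ ε : ℝ, 0 < ε → prePack μ 1 t E ≤ ENNReal.ofReal (2 * ε) ^ t := fun ε hε =>
    (iInf₂_le ε hε).trans <| iSup_le fun _ => iSup_le fun _ => iSup_le fun _ => iSup_le fun h =>
      packSum_one_le μ ht.le h
  have hcont : Continuous fun ε : ℝ => ENNReal.ofReal (2 * ε) ^ t :=
    ENNReal.continuous_rpow_const.comp (ENNReal.continuous_ofReal.comp (by fun_prop))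
  have hlim : Tendsto (fun ε : ℝ => ENNReal.ofReal (2 * ε) ^ t) (𝓝[>] 0) (𝓝 0) := by
    have := (hcont.tendsto 0).mono_left (nhdsWithin_le_nhds (s := Ioi 0))
    simpa [ENNReal.zero_rpow_of_pos ht] using this
  exact nonpos_iff_eq_zero.1 <| ge_of_tendsto hlim <|
    eventually_mem_nhdsWithin.mono fun ε hε => hle ε hε

theorem mfDim_one_le [BorelSpace X] (μ : Measure X) [IsProbabilityMeasure μ] {t : ℝ}
    (ht : 0 < t) (E : Set X) : mfDim μ 1 E ≤ t := by
  refine iInf₂_le t (nonpos_iff_eq_zero.1 ?_)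
  refine (iInf₂_le (fun _ => E) (subset_iUnion (fun _ : ℕ => E) 0)).trans ?_
  simp [prePack_one_eq_zero μ ht]

theorem hasDerivWithinAt_Iio_le_neg_one {f : ℝ → ℝ} {D : ℝ} (h₁ : f 1 ≤ 0)
    (hf : ∀ q < 1, 1 - q ≤ f q) (hD : HasDerivWithinAt f D (Iio 1) 1) : D ≤ -1 := by
  rw [hasDerivWithinAt_iff_tendsto_slope' (by simp)] at hD
  refine le_of_tendsto hD (eventually_mem_nhdsWithin.mono fun q (hq : q < 1) => ?_)
  rw [slope_def_field, div_le_iff_of_neg (by linarith)]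
  linarith [hf q hq]

/-- **Proposition 5.** If `supp μ = [0,1]` and `μ` is dominated by a multiple of Lebesgue
measure on balls centered near a set `A` of positive Lebesgue measure, then `B_μ(q) ≥ 1 - q`
for all `q < 1`; consequently any left derivative of `B_μ` at `1` is at most `-1`. -/
theorem Bmu_left_deriv_le (μ : Measure ℝ) [IsProbabilityMeasure μ]
    (hsupp : msupp μ = Set.Icc (0 : ℝ) 1)
    (C ε₀ : ℝ) (hC : 0 < C) (hε₀ : 0 < ε₀)
    (A : Set ℝ) (hA : A ⊆ Set.Icc (0 : ℝ) 1) (hAm : MeasurableSet A)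
    (hAv : 0 < MeasureTheory.volume A)
    (hloc : ∀ δ : ℝ, 0 < δ → δ < ε₀ → ∀ x : ℝ, (∃ a ∈ A, |x - a| ≤ ε₀) →
      μ (closedBall x δ) ≤ ENNReal.ofReal (C * (2 * δ))) :
    (∀ q : ℝ, q < 1 → ((1 - q : ℝ) : EReal) ≤ Bmu μ q) ∧
    (∀ (f : ℝ → ℝ) (D : ℝ), (∀ q : ℝ, (f q : EReal) = Bmu μ q) →
      HasDerivWithinAt f D (Set.Iio (1 : ℝ)) 1 → D ≤ -1) := by
  have hlower : ∀ q : ℝ, q < 1 → ((1 - q : ℝ) : EReal) ≤ Bmu μ q := by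
    intro q hq
    refine le_iInf₂ fun t ht₀ => EReal.coe_le_coe_iff.2 (le_of_not_gt fun ht => ?_)
    obtain ⟨a, ha⟩ := nonempty_of_measure_ne_zero hAv.ne'
    have hU : ∀ δ : ℝ, 0 < δ → δ < ε₀ → ∀ x ∈ ball a ε₀,
        μ (closedBall x δ) ≤ ENNReal.ofReal C * ENNReal.ofReal (2 * δ) := by
      intro δ hδ hδε x hx
      rw [← ENNReal.ofReal_mul hC.le]
      exact hloc δ hδ hδε x ⟨a, ha, by simpa [Real.dist_eq] using (mem_ball.1 hx).le⟩
    have hpos : 0 < μ (msupp μ ∩ ball a ε₀) := by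
      rw [inter_comm, measure_inter_conull (measure_compl_msupp μ)]
      have hmem : a ∈ msupp μ := hsupp ▸ hA ha
      exact hmem ε₀ hε₀
    have hle := rpow_mul_measure_le_packMeas μ hε₀ hq ht (E := msupp μ) hU
    rw [ht₀, nonpos_iff_eq_zero, mul_eq_zero] at hle
    exact hle.elim (ENNReal.rpow_pos (ENNReal.ofReal_pos.2 hC) ENNReal.ofReal_ne_top).ne' hpos.ne'
  refine ⟨hlower, fun f D hf hD => hasDerivWithinAt_Iio_le_neg_one ?_ ?_ hD⟩
  · refine le_of_forall_pos_le_add fun t ht => ?_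
    rw [zero_add, ← EReal.coe_le_coe_iff, hf]
    exact mfDim_one_le μ ht _
  · intro q hq
    rw [← EReal.coe_le_coe_iff, hf]
    exact hlower q hq

end
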